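/- Let K be a field with nontrivial non-archimedean valuation v with value group Γ dense in ℝ, T the n-torus over K, X a closed subscheme of T, and let Trop_W(X) ⊂ ℝⁿ × ℝ≥0 be the union over ε ≥ 0 of Trop_{εv}(X) × {ε}. Then Trop_W(X) is a closed cone: it is stable under scaling by ℝ≥0, its fiber over each ε > 0 is ε·Trop_v(X), and it equals the closure in ℝⁿ × ℝ≥0 of the cone generated by Trop_v(X) × {1}. -/

import Mathlib

open scoped BigOperators Pointwise

/-- A point of the analytification of the closed subscheme of the split torus defined by
the ideal `I`, with respect to the valuation `ε·v` (equivalently, the absolute value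
`abs^ε`; `ε = 0` gives the trivial absolute value):  a multiplicative seminorm on the
Laurent polynomial ring extending `abs^ε` and vanishing on `I`. -/
def IsBerkPointPow {K : Type*} [Field K] {n : ℕ} (abs : K → ℝ) (ε : ℝ)
    (I : Ideal (AddMonoidAlgebra K (Fin n → ℤ)))
    (p : AddMonoidAlgebra K (Fin n → ℤ) → ℝ) : Prop :=
  (∀ f, 0 ≤ p f) ∧
  (∀ f g, p (f * g) = p f * p g) ∧
  (∀ f g, p (f + g) ≤ max (p f) (p g)) ∧
  (∀ α : K, α ≠ 0 → p (AddMonoidAlgebra.single (0 : Fin n → ℤ) α) = abs α ^ ε) ∧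
  (p 0 = 0) ∧
  (∀ f ∈ I, p f = 0)

/-- The tropicalization map `trop(p) = (−log p(x₁),…,−log p(x_n))`. -/
noncomputable def tropOfPoint {K : Type*} [Field K] {n : ℕ}
    (p : AddMonoidAlgebra K (Fin n → ℤ) → ℝ) : Fin n → ℝ :=
  fun i => - Real.log (p (AddMonoidAlgebra.single (Pi.single i 1 : Fin n → ℤ) (1 : K)))

/-- The tropical variety of `X` with respect to the valuation `ε·v`. -/
noncomputable def tropSet {K : Type*} [Field K] {n : ℕ} (abs : K → ℝ) (ε : ℝ)
    (I : Ideal (AddMonoidAlgebra K (Fin n → ℤ))) : Set (Fin n → ℝ) :=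
  {ω | ∃ p, IsBerkPointPow abs ε I p ∧ tropOfPoint p = ω}

/-- The tropical cone `Trop_W(X) ⊆ ℝⁿ × ℝ≥0`, the union over `ε ≥ 0` of
`Trop_{εv}(X) × {ε}`. -/
noncomputable def tropCone {K : Type*} [Field K] {n : ℕ} (abs : K → ℝ)
    (I : Ideal (AddMonoidAlgebra K (Fin n → ℤ))) : Set ((Fin n → ℝ) × ℝ) :=
  {x | 0 ≤ x.2 ∧ x.1 ∈ tropSet abs x.2 I}

theorem lemB {K L Γ : Type*} [Field K] [Field L] [Algebra K L] [LinearOrderedCommGroupWithZero Γ]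
    (abs : K → ℝ)
    (habs_nonneg : ∀ α, 0 ≤ abs α)
    (habs_zero : ∀ α, abs α = 0 ↔ α = 0)
    (habs_mul : ∀ α β, abs (α * β) = abs α * abs β)
    (v : Valuation L Γ)
    (hv : ∀ c d : K, v (algebraMap K L c) ≤ v (algebraMap K L d) ↔ abs c ≤ abs d)
    (ht : ∀ x : L, x ≠ 0 → ∃ m : ℕ, 0 < m ∧ ∃ c : K, v x ^ m = v (algebraMap K L c)) :
    ∃ q : L → ℝ, (∀ x, 0 ≤ q x) ∧ (∀ x, q x = 0 ↔ x = 0) ∧ (∀ x y, q (x * y) = q x * q y) ∧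
      (∀ x y, q (x + y) ≤ max (q x) (q y)) ∧ (∀ c : K, q (algebraMap K L c) = abs c) ∧
      ∀ x, v x ≤ 1 → q x ≤ 1 := by
  have abs_one : abs 1 = 1 := by
    have h1 := habs_mul 1 1
    have h2 : abs 1 ≠ 0 := fun h => one_ne_zero ((habs_zero 1).1 h)
    rw [mul_one] at h1
    exact (mul_right_cancel₀ h2 (by rw [← h1, one_mul])).symm
  have abs_pow : ∀ (a : K) (n : ℕ), abs (a ^ n) = abs a ^ n := by
    intro a n
    induction n with
    | zero => simp [abs_one]
    | succ n ih => rw [pow_succ, habs_mul, ih, pow_succ]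
  have ht' : ∀ x : L, ∃ m : ℕ, 0 < m ∧ ∃ c : K, v x ^ m = v (algebraMap K L c) := by
    intro x
    by_cases hx : x = 0
    · exact ⟨1, one_pos, 0, by simp [hx]⟩
    · exact ht x hx
  choose m hm c hc using ht'
  let q : L → ℝ := fun x => (abs (c x)) ^ ((m x : ℝ)⁻¹)
  have qn : ∀ x, 0 ≤ q x := fun x => Real.rpow_nonneg (habs_nonneg _) _
  have qpow : ∀ x, q x ^ m x = abs (c x) := fun x =>
    Real.rpow_inv_natCast_pow (habs_nonneg _) (hm x).ne'
  have key : ∀ (x : L) (k : ℕ), 0 < k → ∀ d : K, v x ^ k = v (algebraMap K L d) →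
      q x ^ k = abs d := by
    intro x k hk d h
    have h1 : v (algebraMap K L (c x ^ k)) = v (algebraMap K L (d ^ m x)) := by
      simp only [map_pow]
      rw [← hc, ← h, ← pow_mul, ← pow_mul, mul_comm]
    have h2 : abs (c x ^ k) = abs (d ^ m x) :=
      le_antisymm ((hv _ _).1 h1.le) ((hv _ _).1 h1.ge)
    rw [abs_pow, abs_pow, ← qpow, ← pow_mul, mul_comm, pow_mul] at h2
    exact (pow_left_inj₀ (pow_nonneg (qn x) _) (habs_nonneg _) (hm x).ne').1 h2
  have mono : ∀ x y, v x ≤ v y → q x ≤ q y := by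
    intro x y h
    have hp : 0 < m x * m y := Nat.mul_pos (hm x) (hm y)
    have h1 : q x ^ (m x * m y) = abs (c x ^ m y) := 
      key x _ hp _ (by rw [pow_mul, hc, map_pow, map_pow])
    have h2 : q y ^ (m x * m y) = abs (c y ^ m x) := 
      key y _ hp _ (by rw [mul_comm, pow_mul, hc, map_pow, map_pow])
    have h3 : q x ^ (m x * m y) ≤ q y ^ (m x * m y) := by
      rw [h1, h2, ← hv, map_pow, map_pow, map_pow, map_pow, ← hc, ← hc, ← pow_mul, ← pow_mul,
        mul_comm (m y)]
      exact pow_le_pow_left₀ zero_le h _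
    exact (pow_le_pow_iff_left₀ (qn x) (qn y) hp.ne').1 h3
  have qK : ∀ d : K, q (algebraMap K L d) = abs d := fun d => by
    simpa using key (algebraMap K L d) 1 one_pos d (by simp)
  have q1 : q 1 = 1 := by rw [← map_one (algebraMap K L), qK, abs_one]
  refine ⟨q, qn, ?_, ?_, ?_, qK, ?_⟩
  · intro x
    constructor
    · intro h
      have h1 := qpow x
      rw [h, zero_pow (hm x).ne', eq_comm, habs_zero] at h1
      have h2 := hc x
      rw [h1, map_zero, map_zero] at h2
      simpa using pow_eq_zero_iff (hm x).ne' |>.1 h2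
    · rintro rfl
      rw [← map_zero (algebraMap K L), qK, habs_zero]
  · intro x y
    have hp : 0 < m x * m y := Nat.mul_pos (hm x) (hm y)
    have h1 : q x ^ (m x * m y) = abs (c x ^ m y) := 
      key x _ hp _ (by rw [pow_mul, hc, map_pow, map_pow])
    have h2 : q y ^ (m x * m y) = abs (c y ^ m x) := 
      key y _ hp _ (by rw [mul_comm, pow_mul, hc, map_pow, map_pow])
    have h3 : q (x * y) ^ (m x * m y) = abs (c x ^ m y * c y ^ m x) := 
      key _ _ hp _ (by
        rw [map_mul, mul_pow, pow_mul, hc, mul_comm (m x), pow_mul, hc]; simp only [map_mul, map_pow])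
    rw [habs_mul, ← h1, ← h2, ← mul_pow] at h3
    exact (pow_left_inj₀ (qn _) (mul_nonneg (qn x) (qn y)) hp.ne').1 h3
  · intro x y
    rcases le_total (v x) (v y) with h | h
    · exact (mono _ _ ((v.map_add x y).trans (max_le h le_rfl))).trans (le_max_right _ _)
    · exact (mono _ _ ((v.map_add x y).trans (max_le le_rfl h))).trans (le_max_left _ _)
  · intro x h
    rw [← q1]
    exact mono _ _ (by simpa using h)

theorem lemT {L Γ ι : Type*} [Field L] [LinearOrderedCommGroupWithZero Γ]
    (v : Valuation L Γ) (s : Finset ι) (f : ι → L) (h0 : ∑ i ∈ s, f i = 0) 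
    (i0 : ι) (hi0 : i0 ∈ s) (hf : f i0 ≠ 0) :
    ∃ i ∈ s, ∃ j ∈ s, i ≠ j ∧ f i ≠ 0 ∧ v (f i) = v (f j) := by
  classical
  by_contra hcon
  push Not at hcon
  obtain ⟨i, hi, hmax⟩ := s.exists_max_image (fun i => v (f i)) ⟨i0, hi0⟩
  have hfi : f i ≠ 0 := by
    intro h
    have := hmax i0 hi0
    simp [h] at this
    exact hf this
  have hlt : v (∑ j ∈ s.erase i, f j) < v (f i) := by
    apply v.map_sum_lt ((v.ne_zero_iff).2 hfi)
    intro j hj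
    rw [Finset.mem_erase] at hj
    exact lt_of_le_of_ne (hmax j hj.2) fun h => hcon i hi j hj.2 hj.1.symm hfi h.symm
  rw [← Finset.add_sum_erase s f hi] at h0
  have : f i = - ∑ j ∈ s.erase i, f j := eq_neg_of_add_eq_zero_left h0
  rw [this, v.map_neg] at hlt
  exact lt_irrefl _ hlt
theorem lemZ {O A : Type*} [CommRing O] (m : Ideal O) [hm : m.IsMaximal] [CommRing A] [Algebra O A]
    [Algebra.FiniteType O A] (hne : m.map (algebraMap O A) ≠ ⊤) :
    ∃ (e : ℕ) (z : Fin e → A) (Q : Ideal A), Q.IsPrime ∧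
      (∀ f : MvPolynomial (Fin e) O, MvPolynomial.aeval z f ∈ Q ↔
        MvPolynomial.map (Ideal.Quotient.mk m) f = 0) ∧
      ∃ r ∉ Q, (MvPolynomial.aeval (R := O) z).toRingHom.IsIntegralElem r ∧
        ∀ x, ∃ k : ℕ, (MvPolynomial.aeval (R := O) z).toRingHom.IsIntegralElem (r ^ k * x) := by
  classical
  let : Field (O ⧸ m) := Ideal.Quotient.field m
  let J : Ideal A := m.map (algebraMap O A)
  have hJ : J ≠ ⊤ := hne
  have : Nontrivial (A ⧸ J) := Ideal.Quotient.nontrivial_iff.mpr hJ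
  let alg : Algebra (O ⧸ m) (A ⧸ J) :=
    (Ideal.quotientMap J (algebraMap O A) Ideal.le_comap_map).toAlgebra
  have tow : IsScalarTower O (O ⧸ m) (A ⧸ J) := by
    refine IsScalarTower.of_algebraMap_eq fun x => ?_
    rfl
  have : Algebra.FiniteType O (A ⧸ J) := 
    Algebra.FiniteType.of_surjective (Ideal.Quotient.mkₐ O J) Ideal.Quotient.mk_surjective
  have : Algebra.FiniteType (O ⧸ m) (A ⧸ J) := Algebra.FiniteType.of_restrictScalars_finiteType O _ _
  obtain ⟨e, g, ginj, gfin⟩ := exists_finite_inj_algHom_of_fg (O ⧸ m) (A ⧸ J)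
  choose z hz using fun i => Ideal.Quotient.mk_surjective (I := J) (g (MvPolynomial.X i))
  have hcomm : ∀ f : MvPolynomial (Fin e) O, Ideal.Quotient.mk J (MvPolynomial.aeval z f) =
      g (MvPolynomial.map (Ideal.Quotient.mk m) f) := by
    intro f
    induction f using MvPolynomial.induction_on with
    | C a => 
      simp only [MvPolynomial.aeval_C, MvPolynomial.map_C]
      rw [← MvPolynomial.algebraMap_eq, AlgHom.commutes]
      rfl
    | add p q hp hq => simp only [map_add, hp, hq]
    | mul_X p i hp => simp only [map_mul, hp, MvPolynomial.aeval_X, MvPolynomial.map_X, hz]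
  obtain ⟨Q0, hQ0, hQ0'⟩ : ∃ Q0 : Ideal (A ⧸ J), Q0.IsPrime ∧ Q0.comap g.toRingHom = ⊥ := by
    let := g.toRingHom.toAlgebra
    have : Algebra.IsIntegral (MvPolynomial (Fin e) (O ⧸ m)) (A ⧸ J) := 
      ⟨gfin.to_isIntegral⟩
    obtain ⟨Q, -, h1, h2⟩ := Ideal.exists_ideal_over_prime_of_isIntegral 
      (⊥ : Ideal (MvPolynomial (Fin e) (O ⧸ m))) (⊥ : Ideal (A ⧸ J)) (by
        intro x hx
        have : g x = 0 := hx
        simpa using ginj (this.trans (map_zero g).symm))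
    exact ⟨Q, h1, h2⟩
  let Q : Ideal A := Q0.comap (Ideal.Quotient.mk J)
  have hQ : Q.IsPrime := Ideal.IsPrime.comap _
  have key : ∀ f : MvPolynomial (Fin e) O, MvPolynomial.aeval z f ∈ Q ↔
        MvPolynomial.map (Ideal.Quotient.mk m) f = 0 := by
    intro f
    change Ideal.Quotient.mk J (MvPolynomial.aeval z f) ∈ Q0 ↔ _
    rw [hcomm]
    change MvPolynomial.map (Ideal.Quotient.mk m) f ∈ Q0.comap g.toRingHom ↔ _
    rw [hQ0']; rfl
  refine ⟨e, z, Q, hQ, key, ?_⟩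
  let algR : Algebra (MvPolynomial (Fin e) O) A := (MvPolynomial.aeval (R := O) z).toRingHom.toAlgebra
  have towR : IsScalarTower O (MvPolynomial (Fin e) O) A := 
    IsScalarTower.of_algebraMap_eq fun x => by
      change _ = MvPolynomial.aeval z (MvPolynomial.C x)
      simp
  have : Algebra.FiniteType (MvPolynomial (Fin e) O) A := 
    Algebra.FiniteType.of_restrictScalars_finiteType O _ _
  have hJ' : (Q.under (MvPolynomial (Fin e) O)).map (algebraMap (MvPolynomial (Fin e) O) A) = J := by
    apply le_antisymm
    · rw [Ideal.map_le_iff_le_comap]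
      intro f hf
      have h1 : MvPolynomial.aeval z f ∈ Q := hf
      rw [key] at h1
      change MvPolynomial.aeval z f ∈ J
      rw [← Ideal.Quotient.eq_zero_iff_mem, hcomm, h1, map_zero]
    · rw [Ideal.map_le_iff_le_comap]
      intro a ha
      have : algebraMap O A a = algebraMap (MvPolynomial (Fin e) O) A (MvPolynomial.C a) := by
        rw [IsScalarTower.algebraMap_apply O (MvPolynomial (Fin e) O) A]; rfl
      rw [Ideal.mem_comap, this]
      apply Ideal.mem_map_of_mem
      change MvPolynomial.aeval z (MvPolynomial.C a) ∈ Q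
      rw [key]
      simpa using Ideal.Quotient.eq_zero_iff_mem.mpr ha
  have hfin : Module.Finite (MvPolynomial (Fin e) O) (A ⧸ J) := by
    have h1 : (g.toRingHom.comp (MvPolynomial.map (Ideal.Quotient.mk m))).Finite :=
      RingHom.Finite.comp gfin (RingHom.Finite.of_surjective _ 
        (MvPolynomial.map_surjective _ Ideal.Quotient.mk_surjective))
    have h2 : (algebraMap (MvPolynomial (Fin e) O) (A ⧸ J)) = 
      (g.toRingHom.comp (MvPolynomial.map (Ideal.Quotient.mk m))) := by
      refine RingHom.ext fun f => ?_
      exact hcomm f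
    rw [← h2] at h1
    exact RingHom.finite_algebraMap.mp h1
  have : Algebra.WeaklyQuasiFiniteAt (MvPolynomial (Fin e) O) Q := by
    have : Module.Finite (MvPolynomial (Fin e) O) (A ⧸ 
      (Q.under (MvPolynomial (Fin e) O)).map (algebraMap (MvPolynomial (Fin e) O) A)) := by
      rw [hJ']; exact hfin
    unfold Algebra.WeaklyQuasiFiniteAt
    infer_instance
  have := Algebra.ZariskisMainProperty.of_finiteType_of_weaklyQuasiFiniteAt 
    (R := MvPolynomial (Fin e) O) Q
  rw [Algebra.zariskisMainProperty_iff] at this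
  exact this

theorem lemDom {L : Type*} [Field L] (A : Subring L) (Q : Ideal A) [Q.IsPrime] :
    ∃ W : ValuationSubring L, (∀ a : A, W.valuation (a : L) ≤ 1) ∧ 
      (∀ a ∈ Q, W.valuation (a : L) < 1) ∧ ∀ a ∉ Q, W.valuation (a : L) = 1 := by
  obtain ⟨V, hV⟩ := (LocalSubring.ofPrime A Q).exists_le_valuationSubring
  have hle : ∀ a : A, V.valuation (a : L) ≤ 1 := fun a => 
    (V.valuation_le_one_iff _).2 (((LocalSubring.le_ofPrime A Q).trans hV.1) a.2)
  refine ⟨V, hle, ?_, ?_⟩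
  · intro x hx
    have : algebraMap A (LocalSubring.ofPrime A Q).toSubring x ∈
        IsLocalRing.maximalIdeal (LocalSubring.ofPrime A Q).toSubring := by
      rw [← IsLocalization.AtPrime.map_eq_maximalIdeal Q]
      exact Ideal.mem_map_of_mem _ hx
    have hh : IsLocalHom (Subring.inclusion hV.1) := hV.2
    rw [IsLocalRing.mem_maximalIdeal, mem_nonunits_iff] at this
    have h2 : (⟨x, hV.1 (LocalSubring.le_ofPrime A Q x.2)⟩ : V) ∈ IsLocalRing.maximalIdeal V := by
      rw [IsLocalRing.mem_maximalIdeal, mem_nonunits_iff]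
      intro hu
      exact this (hh.map_nonunit _ hu)
    exact (V.valuation_lt_one_iff _).1 h2
  · intro x hx
    have hu : IsUnit (algebraMap A (LocalSubring.ofPrime A Q).toSubring x) :=
      IsLocalization.map_units (M := Q.primeCompl) _ ⟨x, hx⟩
    have h2 := hu.map (Subring.inclusion hV.1)
    exact (V.valuation_eq_one_iff ⟨_, _⟩).1 h2

theorem lemA {K L : Type*} [Field K] [Field L] [Algebra K L] 
    (abs : K → ℝ)
    (habs_nonneg : ∀ α, 0 ≤ abs α)
    (habs_zero : ∀ α, abs α = 0 ↔ α = 0)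
    (habs_mul : ∀ α β, abs (α * β) = abs α * abs β)
    (O : ValuationSubring K) (hO : ∀ a, a ∈ O ↔ abs a ≤ 1)
    (A : Subalgebra O L) [Algebra.FiniteType O A]
    (hne : (IsLocalRing.maximalIdeal O).map (algebraMap O A) ≠ ⊤)
    (hfrac : ∀ x : L, ∃ a ∈ A, ∃ b ∈ A, x = a / b) :
    ∃ q : L → ℝ, (∀ x, 0 ≤ q x) ∧ (∀ x, q x = 0 ↔ x = 0) ∧ (∀ x y, q (x * y) = q x * q y) ∧
      (∀ x y, q (x + y) ≤ max (q x) (q y)) ∧ (∀ c : K, q (algebraMap K L c) = abs c) ∧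
      ∀ x ∈ A, q x ≤ 1 := by
  classical
  obtain ⟨e, z, Q, hQ, key, r, hrQ, hrint, hint⟩ := lemZ (IsLocalRing.maximalIdeal O) hne
  obtain ⟨W, hW1, hW2, hW3⟩ := lemDom A.toSubring Q
  replace hW1 : ∀ a : A, W.valuation (a : L) ≤ 1 := hW1
  replace hW2 : ∀ a : A, a ∈ Q → W.valuation (a : L) < 1 := hW2
  replace hW3 : ∀ a : A, a ∉ Q → W.valuation (a : L) = 1 := hW3
  set v := W.valuation with hvdef
  have hinj : ∀ c : K, algebraMap K L c = 0 ↔ c = 0 := fun c => by simp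
  have abs_one : abs 1 = 1 := by
    have h1 := habs_mul 1 1
    have h2 : abs 1 ≠ 0 := fun h => one_ne_zero ((habs_zero 1).1 h)
    rw [mul_one] at h1
    exact (mul_right_cancel₀ h2 (by rw [← h1, one_mul])).symm
  have abs_inv : ∀ a : K, abs a⁻¹ = (abs a)⁻¹ := by
    intro a
    by_cases ha : a = 0
    · simp [ha, (habs_zero 0).2 rfl]
    · apply eq_inv_of_mul_eq_one_left
      rw [← habs_mul, inv_mul_cancel₀ ha, abs_one]
  have hmem : ∀ a : O, a ∈ IsLocalRing.maximalIdeal O ↔ abs a < 1 := by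
    intro a
    rw [IsLocalRing.mem_maximalIdeal, mem_nonunits_iff, ← not_le, not_iff_not]
    constructor
    · rintro ⟨u, rfl⟩
      have h1 : abs ((u : O) : K) * abs ((u⁻¹ : Oˣ) : O) = 1 := by
        rw [← habs_mul, ← abs_one]
        congr 1
        have := u.mul_inv
        exact_mod_cast congrArg (Subtype.val) this
      have h2 := (hO _).1 ((u⁻¹ : Oˣ) : O).2
      calc (1:ℝ) = _ := h1.symm
        _ ≤ abs ((u : O) : K) * 1 := mul_le_mul_of_nonneg_left h2 (habs_nonneg _)
        _ = _ := mul_one _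
    · intro h
      have h0 : (a : K) ≠ 0 := by
        intro h0
        rw [(habs_zero _).2 h0] at h; linarith
      refine IsUnit.of_mul_eq_one (⟨(a : K)⁻¹, (hO _).2 ?_⟩ : O) ?_
      · rw [abs_inv]; exact inv_le_one_of_one_le₀ h
      · ext; simp [h0]
  have vC : ∀ a : O, a ∉ IsLocalRing.maximalIdeal O → v (algebraMap K L a) = 1 := by
    intro a ha
    have := hW3 (MvPolynomial.aeval z (MvPolynomial.C a)) (by
      rw [key]; simpa [Ideal.Quotient.eq_zero_iff_mem] using ha)
    rw [MvPolynomial.aeval_C] at this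
    exact this
  have vC' : ∀ a : O, a ∈ IsLocalRing.maximalIdeal O → v (algebraMap K L a) < 1 := by
    intro a ha
    have := hW2 (MvPolynomial.aeval z (MvPolynomial.C a)) (by
      rw [key]; simpa [Ideal.Quotient.eq_zero_iff_mem] using ha)
    rw [MvPolynomial.aeval_C] at this
    exact this
  have vle : ∀ a : K, v (algebraMap K L a) ≤ 1 ↔ abs a ≤ 1 := by
    intro a
    constructor
    · intro h
      by_contra hcon
      push Not at hcon
      have ha0 : a ≠ 0 := by
        rintro rfl
        rw [(habs_zero _).2 rfl] at hcon; linarith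
      have h1 : abs a⁻¹ < 1 := by rw [abs_inv]; exact inv_lt_one_of_one_lt₀ hcon
      have h2 := vC' ⟨a⁻¹, (hO _).2 h1.le⟩ ((hmem _).2 h1)
      simp only [map_inv₀] at h2
      have h3 : v (algebraMap K L a) ≠ 0 := by simpa using ha0
      have := (inv_lt_one₀ (zero_lt_iff.2 h3)).1 h2
      exact absurd h this.not_ge
    · intro h
      by_cases h1 : (⟨a, (hO _).2 h⟩ : O) ∈ IsLocalRing.maximalIdeal O
      · exact (vC' _ h1).le
      · exact (vC _ h1).le
  have hv : ∀ c d : K, v (algebraMap K L c) ≤ v (algebraMap K L d) ↔ abs c ≤ abs d := by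
    intro c d
    by_cases hd : d = 0
    · subst hd
      rw [(habs_zero 0).2 rfl]
      simp only [map_zero, le_zero_iff]
      simp only [map_eq_zero]
      rw [← habs_zero]
      exact ⟨fun h => h.le, fun h => le_antisymm h (habs_nonneg _)⟩
    · have h1 := vle (c / d)
      have hd' : 0 < abs d := lt_of_le_of_ne (habs_nonneg _) fun h => hd ((habs_zero _).1 h.symm)
      have hdvv : 0 < v (algebraMap K L d) := zero_lt_iff.2 (by simpa using hd)
      rw [map_div₀, map_div₀, div_le_one₀ hdvv, div_eq_mul_inv, habs_mul, abs_inv, 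
        ← div_eq_mul_inv, div_le_one₀ hd'] at h1
      exact h1
  have hR : ∀ f : MvPolynomial (Fin e) O, f ≠ 0 → ∃ c : K, c ≠ 0 ∧ 
      v ((MvPolynomial.aeval z f : A) : L) = v (algebraMap K L c) := by
    intro f hf
    obtain ⟨u, hu, hmax⟩ := f.support.exists_max_image (fun u => abs ((f.coeff u : O) : K)) 
      (MvPolynomial.support_nonempty.2 hf)
    rw [MvPolynomial.mem_support_iff] at hu
    have hcu : ((f.coeff u : O) : K) ≠ 0 := by simpa using hu
    have hcu' : 0 < abs ((f.coeff u : O) : K) := 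
      lt_of_le_of_ne (habs_nonneg _) fun h => hcu ((habs_zero _).1 h.symm)
    have hdvd : MvPolynomial.C (f.coeff u) ∣ f := by
      rw [MvPolynomial.C_dvd_iff_dvd_coeff]
      intro w
      have hle : abs ((f.coeff w : O) : K) ≤ abs ((f.coeff u : O) : K) := by
        by_cases hw : w ∈ f.support
        · exact hmax w hw
        · rw [MvPolynomial.notMem_support_iff.1 hw]
          simpa [(habs_zero 0).2 rfl] using habs_nonneg _
      refine ⟨⟨((f.coeff w : O) : K) / (f.coeff u : O), (hO _).2 ?_⟩, ?_⟩
      · rw [div_eq_mul_inv, habs_mul, abs_inv, ← div_eq_mul_inv]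
        exact (div_le_one₀ hcu').2 hle
      · ext
        simp [mul_div_cancel₀, hcu]
    obtain ⟨g, hg⟩ := hdvd
    have hg1 : g.coeff u = 1 := by
      have h1 := congrArg (MvPolynomial.coeff u) hg
      rw [MvPolynomial.coeff_C_mul] at h1
      exact (mul_left_cancel₀ hu (by rw [← h1, mul_one]))
    have hgQ : MvPolynomial.aeval z g ∉ Q := by
      rw [key]
      intro h
      have h1 := congrArg (MvPolynomial.coeff u) h
      rw [MvPolynomial.coeff_map, hg1] at h1
      simp at h1
    refine ⟨(f.coeff u : O), hcu, ?_⟩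
    have h3 := hW3 _ hgQ
    conv_lhs => rw [hg]
    rw [map_mul, MvPolynomial.aeval_C]
    rw [Subalgebra.coe_mul, map_mul, h3, mul_one]
    rfl
  have hI : ∀ x : A, x ≠ 0 → (MvPolynomial.aeval (R := O) z).toRingHom.IsIntegralElem x →
      ∃ m : ℕ, 0 < m ∧ ∃ c : K, v (x : L) ^ m = v (algebraMap K L c) := by
    rintro x hx ⟨P, hPm, hP⟩
    have hx' : (x : L) ≠ 0 := by simpa using hx
    have hvx : v (x : L) ≠ 0 := by simpa using hx
    rw [Polynomial.eval₂_eq_sum, Polynomial.sum_def] at hP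
    have hP' : ∑ i ∈ P.support, ((MvPolynomial.aeval z (P.coeff i) : A) : L) * (x : L) ^ i = 0 := by
      have := congrArg (A.val) hP
      rw [map_sum] at this
      simpa using this
    have hne : ∀ i ∈ P.support, ((MvPolynomial.aeval z (P.coeff i) : A) : L) * (x : L) ^ i ≠ 0 := by
      intro i hi
      refine mul_ne_zero ?_ (pow_ne_zero _ hx')
      obtain ⟨c, hc, h⟩ := hR _ (Polynomial.mem_support_iff.1 hi)
      intro h0
      rw [h0] at h
      rw [map_zero, eq_comm, map_eq_zero, map_eq_zero] at h
      exact hc h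
    have hd : P.natDegree ∈ P.support := Polynomial.natDegree_mem_support_of_nonzero hPm.ne_zero
    obtain ⟨i, hi, j, hj, hij, h0, hvv⟩ := lemT v _ _ hP' _ hd (hne _ hd)
    wlog hlt : i < j generalizing i j
    · exact this j hj i hi hij.symm (hne _ hj) hvv.symm (lt_of_le_of_ne (not_lt.1 hlt) hij.symm)
    obtain ⟨c, hc, h⟩ := hR _ (Polynomial.mem_support_iff.1 hi)
    obtain ⟨d, hd, h'⟩ := hR _ (Polynomial.mem_support_iff.1 hj)
    refine ⟨j - i, by omega, c / d, ?_⟩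
    rw [map_mul, map_mul, map_pow, map_pow, h, h'] at hvv
    have hdvv : v (algebraMap K L d) ≠ 0 := by simpa using hd
    rw [map_div₀, map_div₀, eq_div_iff hdvv]
    have hpi : v (x : L) ^ i ≠ 0 := pow_ne_zero _ hvx
    apply mul_right_cancel₀ hpi
    rw [hvv, mul_right_comm, ← pow_add, Nat.sub_add_cancel hlt.le, mul_comm]
  have hr0 : r ≠ 0 := fun h => hrQ (h ▸ Q.zero_mem)
  have hA : ∀ x : A, x ≠ 0 → 
      ∃ m : ℕ, 0 < m ∧ ∃ c : K, v (x : L) ^ m = v (algebraMap K L c) := by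
    intro x hx
    obtain ⟨k, hk⟩ := hint x
    obtain ⟨m, hm, c, hc⟩ := hI _ (mul_ne_zero (pow_ne_zero k hr0) hx) hk
    refine ⟨m, hm, c, ?_⟩
    have hvr := hW3 r hrQ
    rw [← hc]
    simp [hvr]
  obtain ⟨q, h1, h2, h3, h4, h5, h6⟩ := lemB abs habs_nonneg habs_zero habs_mul v hv (by
    intro x hx
    obtain ⟨a, ha, b, hb, rfl⟩ := hfrac x
    have ha0 : a ≠ 0 := by rintro rfl; simp at hx
    have hb0 : b ≠ 0 := by rintro rfl; simp at hx
    obtain ⟨m, hm, c, hc⟩ := hA ⟨a, ha⟩ (by simpa [Subtype.ext_iff] using ha0)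
    obtain ⟨k, hk, d, hd⟩ := hA ⟨b, hb⟩ (by simpa [Subtype.ext_iff] using hb0)
    refine ⟨m * k, Nat.mul_pos hm hk, c ^ k / d ^ m, ?_⟩
    simp only at hc hd
    rw [map_div₀, div_pow, pow_mul, hc, mul_comm m k, pow_mul, hd]
    simp only [map_div₀, map_pow])
  exact ⟨q, h1, h2, h3, h4, h5, fun x hx => h6 x (hW1 ⟨x, hx⟩)⟩

theorem exOK {K : Type*} [Field K] 
    (abs : K → ℝ)
    (habs_nonneg : ∀ α, 0 ≤ abs α)
    (habs_zero : ∀ α, abs α = 0 ↔ α = 0)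
    (habs_mul : ∀ α β, abs (α * β) = abs α * abs β)
    (habs_add : ∀ α β, abs (α + β) ≤ max (abs α) (abs β)) :
    ∃ O : ValuationSubring K, ∀ a, a ∈ O ↔ abs a ≤ 1 := by
  have abs_one : abs 1 = 1 := by
    have h1 := habs_mul 1 1
    have h2 : abs 1 ≠ 0 := fun h => one_ne_zero ((habs_zero 1).1 h)
    rw [mul_one] at h1
    exact (mul_right_cancel₀ h2 (by rw [← h1, one_mul])).symm
  have abs_neg1 : abs (-1) = 1 := by
    have h1 := habs_mul (-1) (-1)
    rw [neg_mul_neg, one_mul, abs_one] at h1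
    nlinarith [habs_nonneg (-1)]
  have abs_neg : ∀ a, abs (-a) = abs a := fun a => by
    rw [← neg_one_mul, habs_mul, abs_neg1, one_mul]
  refine ⟨ValuationSubring.mk (Subring.mk (Subsemiring.mk (Submonoid.mk (Subsemigroup.mk
    {a | abs a ≤ 1} ?_) ?_) ?_ ?_) ?_) ?_, fun a => Iff.rfl⟩
  · intro a b ha hb
    simp only [Set.mem_setOf_eq] at *
    rw [habs_mul]
    exact mul_le_one₀ ha (habs_nonneg _) hb
  · exact abs_one.le
  · intro a b ha hb
    exact (habs_add a b).trans (max_le ha hb)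
  · change abs 0 ≤ 1
    rw [(habs_zero 0).2 rfl]; exact zero_le_one
  · intro a ha
    change abs (-a) ≤ 1
    rw [abs_neg]; exact ha
  · intro a
    by_cases h0 : a = 0
    · left
      change abs a ≤ 1
      rw [(habs_zero a).2 h0]; exact zero_le_one
    · rcases le_total (abs a) 1 with h | h
      · exact Or.inl h
      · right
        change abs a⁻¹ ≤ 1
        have h1 : abs a * abs a⁻¹ = 1 := by rw [← habs_mul, mul_inv_cancel₀ h0, abs_one]
        nlinarith [habs_nonneg a⁻¹]

theorem exSmall {K : Type*} [Field K] 
    (abs : K → ℝ)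
    (_ : ∀ α, 0 ≤ abs α)
    (habs_zero : ∀ α, abs α = 0 ↔ α = 0)
    (habs_mul : ∀ α β, abs (α * β) = abs α * abs β)
    (hnontriv : ∃ α : K, α ≠ 0 ∧ abs α ≠ 1) (μ : ℝ) (hμ : 0 < μ) :
    ∃ a : K, a ≠ 0 ∧ abs a ≤ μ := by
  have abs_one : abs 1 = 1 := by
    have h1 := habs_mul 1 1
    have h2 : abs 1 ≠ 0 := fun h => one_ne_zero ((habs_zero 1).1 h)
    rw [mul_one] at h1
    exact (mul_right_cancel₀ h2 (by rw [← h1, one_mul])).symm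
  have abs_pow : ∀ (a : K) (n : ℕ), abs (a ^ n) = abs a ^ n := by
    intro a n
    induction n with
    | zero => simp [abs_one]
    | succ n ih => rw [pow_succ, habs_mul, ih, pow_succ]
  obtain ⟨p, hp0, hp1⟩ : ∃ p : K, p ≠ 0 ∧ abs p < 1 := by
    obtain ⟨α, h0, h1⟩ := hnontriv
    rcases lt_or_gt_of_ne h1 with h | h
    · exact ⟨α, h0, h⟩
    · refine ⟨α⁻¹, inv_ne_zero h0, ?_⟩
      have h1 : abs α * abs α⁻¹ = 1 := by rw [← habs_mul, mul_inv_cancel₀ h0, abs_one]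
      by_contra hc
      push Not at hc
      nlinarith
  obtain ⟨n, hn⟩ := exists_pow_lt_of_lt_one hμ hp1
  exact ⟨p ^ n, pow_ne_zero _ hp0, by rw [abs_pow]; exact hn.le⟩

theorem lemM {K L : Type*} [Field K] [Field L] [Algebra K L] 
    (abs : K → ℝ)
    (habs_nonneg : ∀ α, 0 ≤ abs α)
    (habs_zero : ∀ α, abs α = 0 ↔ α = 0)
    (habs_mul : ∀ α β, abs (α * β) = abs α * abs β)
    (habs_add : ∀ α β, abs (α + β) ≤ max (abs α) (abs β))
    (hnontriv : ∃ α : K, α ≠ 0 ∧ abs α ≠ 1)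
    (s : Finset L) (hs : ∀ x : L, x ∈ IntermediateField.adjoin K (s : Set L))
    (y : L) (hyB : y ∈ Algebra.adjoin K (s : Set L)) 
    (hy : ∀ z ∈ Algebra.adjoin K (s : Set L), y * z ≠ 1) :
    ∃ C : ℝ, 0 < C ∧ ∀ μ : ℝ, 0 < μ → 
    ∃ q : L → ℝ, (∀ x, 0 ≤ q x) ∧ (∀ x, q x = 0 ↔ x = 0) ∧ (∀ x y, q (x * y) = q x * q y) ∧
      (∀ x y, q (x + y) ≤ max (q x) (q y)) ∧ (∀ c : K, q (algebraMap K L c) = abs c) ∧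
      (∀ b ∈ s, q b ≤ C) ∧ q y ≤ μ := by
  classical
  obtain ⟨O, hO⟩ := exOK abs habs_nonneg habs_zero habs_mul habs_add
  have abs_pos : ∀ a, a ≠ 0 → 0 < abs a := fun a ha => 
    lt_of_le_of_ne (habs_nonneg _) fun h => ha ((habs_zero _).1 h.symm)
  let B := Algebra.adjoin K (s : Set L)
  have hspan : Ideal.span {(⟨y, hyB⟩ : B)} ≠ ⊤ := by
    rw [Ne, Ideal.span_singleton_eq_top]
    intro hu
    obtain ⟨z, hz⟩ := hu.exists_right_inv
    exact hy z z.2 (congrArg Subtype.val hz)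
  obtain ⟨n, hn, hyn⟩ := Ideal.exists_le_maximal _ hspan
  have hyn' : (⟨y, hyB⟩ : B) ∈ n := hyn (Ideal.mem_span_singleton_self _)
  let F := B ⧸ n
  let : Field F := Ideal.Quotient.field n
  have : Algebra.FiniteType K B := 
    (Subalgebra.fg_iff_finiteType _).1 (Subalgebra.fg_adjoin_finset s)
  have : Algebra.FiniteType K F := 
    Algebra.FiniteType.of_surjective (Ideal.Quotient.mkₐ K n) Ideal.Quotient.mk_surjective
  have : Module.Finite K F := finite_of_finite_type_of_isJacobsonRing K F
  have hd : ∀ x : F, ∃ d : O, d ≠ 0 ∧ IsIntegral O (d • x) := by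
    intro x
    have h1 : IsAlgebraic K x := (IsIntegral.of_finite K x).isAlgebraic
    have h2 : IsAlgebraic O x := (IsFractionRing.isAlgebraic_iff O K F).2 h1
    exact h2.exists_integral_multiple
  obtain ⟨d, hd0, hdint⟩ : ∃ d : O, d ≠ 0 ∧ ∀ b : B, (b : L) ∈ s → 
      IsIntegral O (d • (Ideal.Quotient.mk n b : F)) := by
    choose D hD0 hD using hd
    let T : Finset F := s.attach.image fun b => 
      (Ideal.Quotient.mk n ⟨b.1, Algebra.subset_adjoin b.2⟩ : F)
    refine ⟨∏ x ∈ T, D x, Finset.prod_ne_zero_iff.2 fun x _ => hD0 x, ?_⟩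
    intro b hb
    have hT : (Ideal.Quotient.mk n b : F) ∈ T := 
      Finset.mem_image.2 ⟨⟨b, hb⟩, Finset.mem_attach _ _, rfl⟩
    rw [← Finset.prod_erase_mul _ _ hT, mul_smul]
    exact (hD _).smul _
  have hd0' : (d : K) ≠ 0 := by simpa using hd0
  have hdL : algebraMap K L d ≠ 0 := by simpa using hd0'
  refine ⟨(abs d)⁻¹, inv_pos.2 (abs_pos _ hd0'), fun μ hμ => ?_⟩
  obtain ⟨ε, hε0, hεμ⟩ := exSmall abs habs_nonneg habs_zero habs_mul hnontriv μ hμ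
  have hεL : algebraMap K L ε ≠ 0 := by simpa using hε0
  let T : Finset L := insert (algebraMap K L ε⁻¹ * y) (s.image fun b => algebraMap K L d * b)
  let A : Subalgebra O L := Algebra.adjoin O (T : Set L)
  have : Algebra.FiniteType O A := 
    (Subalgebra.fg_iff_finiteType _).1 (Subalgebra.fg_adjoin_finset T)
  let ψ : B →ₐ[O] F := Ideal.Quotient.mkₐ O n
  let ιB : B →ₐ[O] L := B.val.restrictScalars O
  have hsub : A ≤ ((integralClosure O F).comap ψ).map ιB := by
    refine Algebra.adjoin_le ?_
    intro x hx
    rcases Finset.mem_insert.1 hx with rfl | hx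
    · refine ⟨algebraMap K B ε⁻¹ * ⟨y, hyB⟩, ?_, rfl⟩
      change IsIntegral O (Ideal.Quotient.mk n (algebraMap K B ε⁻¹ * ⟨y, hyB⟩))
      rw [Ideal.Quotient.eq_zero_iff_mem.2 (n.mul_mem_left _ hyn')]
      exact isIntegral_zero
    · obtain ⟨b, hb, rfl⟩ := Finset.mem_image.1 hx
      refine ⟨algebraMap K B d * ⟨b, Algebra.subset_adjoin hb⟩, ?_, rfl⟩
      change IsIntegral O (Ideal.Quotient.mk n (algebraMap K B d * ⟨b, Algebra.subset_adjoin hb⟩))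
      have e : (Ideal.Quotient.mk n (algebraMap K B d * ⟨b, Algebra.subset_adjoin hb⟩) : F) =
          d • (Ideal.Quotient.mk n ⟨b, Algebra.subset_adjoin hb⟩ : F) := by
        rw [← Algebra.smul_def]
        rfl
      rw [e]
      exact hdint ⟨b, Algebra.subset_adjoin hb⟩ hb
  have hinj : Function.Injective ιB := Subtype.val_injective
  have hAB : ∀ x : A, ∃ b : B, (b : L) = x ∧ IsIntegral O (ψ b) := by
    intro x
    obtain ⟨b, hb, hbx⟩ := hsub x.2
    exact ⟨b, hbx, hb⟩
  have hAle : ∀ x : L, x ∈ A → x ∈ B := fun x hx => by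
    obtain ⟨b, hb, -⟩ := hAB ⟨x, hx⟩
    have h : (b : L) = x := hb
    rw [← h]; exact b.2
  let χ0 : A →ₐ[O] B := (A.val).codRestrict (B.restrictScalars O) (fun x => hAle x x.2)
  let χ : A →ₐ[O] integralClosure O F := (ψ.comp χ0).codRestrict (integralClosure O F) (by
    intro x
    obtain ⟨b, hb, hb'⟩ := hAB x
    have : χ0 x = b := Subtype.ext hb.symm
    change IsIntegral O (ψ (χ0 x))
    rw [this]; exact hb')
  have hinjF : Function.Injective (algebraMap O (integralClosure O F)) := by
    have h1 : Function.Injective (algebraMap O F) := by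
      rw [IsScalarTower.algebraMap_eq O K F]
      exact (algebraMap K F).injective.comp (IsFractionRing.injective O K)
    intro a b hab
    exact h1 (congrArg Subtype.val hab)
  obtain ⟨P, -, hP, hPm⟩ := Ideal.exists_ideal_over_prime_of_isIntegral 
    (IsLocalRing.maximalIdeal O) (⊥ : Ideal (integralClosure O F)) (by
      intro x hx
      have : algebraMap O (integralClosure O F) x = 0 := hx
      rw [hinjF (this.trans (map_zero _).symm)]
      exact Ideal.zero_mem _)
  have hne : (IsLocalRing.maximalIdeal O).map (algebraMap O A) ≠ ⊤ := by
    intro htop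
    have hle : (IsLocalRing.maximalIdeal O).map (algebraMap O A) ≤ P.comap χ.toRingHom := by
      rw [Ideal.map_le_iff_le_comap, Ideal.comap_comap]
      have : χ.toRingHom.comp (algebraMap O A) = algebraMap O (integralClosure O F) := 
        χ.comp_algebraMap
      rw [this, hPm]
    rw [htop, top_le_iff, Ideal.comap_eq_top_iff] at hle
    exact hP.ne_top hle
  have hmul : ∀ x ∈ B, ∃ δ : O, δ ≠ 0 ∧ algebraMap K L δ * x ∈ A := by
    intro x hx
    induction hx using Algebra.adjoin_induction with
    | mem x hx => 
      exact ⟨d, hd0, Algebra.subset_adjoin (Finset.mem_insert_of_mem 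
        (Finset.mem_image.2 ⟨x, hx, rfl⟩))⟩
    | algebraMap r => 
      obtain ⟨a, b, hb, hab⟩ := IsFractionRing.div_surjective (A := O) r
      have hb0 : b ≠ 0 := nonZeroDivisors.ne_zero hb
      refine ⟨b, hb0, ?_⟩
      have hb0' : (b : K) ≠ 0 := by simpa using hb0
      have : algebraMap K L b * algebraMap K L r = algebraMap O L a := by
        rw [IsScalarTower.algebraMap_apply O K L, ← map_mul, ← hab]
        congr 1
        change (b : K) * ((a : K) / (b : K)) = a
        field_simp
      rw [this]
      exact A.algebraMap_mem a
    | add x y _ _ hx hy => 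
      obtain ⟨a, ha, hx⟩ := hx
      obtain ⟨b, hb, hy⟩ := hy
      refine ⟨a * b, mul_ne_zero ha hb, ?_⟩
      have : algebraMap K L ((a * b : O) : K) * (x + y) = 
        algebraMap O L b * (algebraMap K L a * x) + algebraMap O L a * (algebraMap K L b * y) := by
        rw [IsScalarTower.algebraMap_apply O K L, IsScalarTower.algebraMap_apply O K L]
        change algebraMap K L ((a : K) * (b : K)) * (x + y) = 
          algebraMap K L b * (algebraMap K L a * x) + algebraMap K L a * (algebraMap K L b * y)
        rw [map_mul]; ring
      rw [this]
      exact A.add_mem (A.mul_mem (A.algebraMap_mem _) hx) (A.mul_mem (A.algebraMap_mem _) hy)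
    | mul x y _ _ hx hy => 
      obtain ⟨a, ha, hx⟩ := hx
      obtain ⟨b, hb, hy⟩ := hy
      refine ⟨a * b, mul_ne_zero ha hb, ?_⟩
      have : algebraMap K L ((a * b : O) : K) * (x * y) = 
        (algebraMap K L a * x) * (algebraMap K L b * y) := by
        change algebraMap K L ((a : K) * (b : K)) * (x * y) = _
        rw [map_mul]; ring
      rw [this]
      exact A.mul_mem hx hy
  obtain ⟨q, h1, h2, h3, h4, h5, h6⟩ := lemA abs habs_nonneg habs_zero habs_mul O hO A hne (by
    intro x
    obtain ⟨a, ha, b, hb, rfl⟩ := IntermediateField.mem_adjoin_iff_div.1 (hs x)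
    obtain ⟨δ, hδ, hδa⟩ := hmul a ha
    obtain ⟨η, hη, hηb⟩ := hmul b hb
    refine ⟨algebraMap O L η * (algebraMap K L δ * a), A.mul_mem (A.algebraMap_mem _) hδa, 
      algebraMap O L δ * (algebraMap K L η * b), A.mul_mem (A.algebraMap_mem _) hηb, ?_⟩
    rw [IsScalarTower.algebraMap_apply O K L, IsScalarTower.algebraMap_apply O K L]
    change a / b = algebraMap K L η * (algebraMap K L δ * a) / 
      (algebraMap K L δ * (algebraMap K L η * b))
    have e1 : algebraMap K L (η : K) ≠ 0 := by simpa using hη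
    have e2 : algebraMap K L (δ : K) ≠ 0 := by simpa using hδ
    by_cases hb0 : b = 0
    · simp [hb0]
    · field_simp)
  refine ⟨q, h1, h2, h3, h4, h5, ?_, ?_⟩
  · intro b hb
    have := h6 _ (Algebra.subset_adjoin (Finset.mem_insert_of_mem 
        (Finset.mem_image.2 ⟨b, hb, rfl⟩)))
    rw [h3, h5] at this
    rw [← one_div, le_div_iff₀ (abs_pos _ hd0'), mul_comm]
    exact this
  · have := h6 _ (Algebra.subset_adjoin (Finset.mem_insert_self _ _))
    have e : y = algebraMap K L ε * (algebraMap K L ε⁻¹ * y) := by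
      rw [map_inv₀]; field_simp
    rw [e, h3, h5]
    calc _ ≤ abs ε * 1 := mul_le_mul_of_nonneg_left this (habs_nonneg _)
      _ ≤ μ := by rw [mul_one]; exact hεμ

theorem auxAbsOne {K : Type*} [Field K] (abs : K → ℝ)
    (habs_zero : ∀ α, abs α = 0 ↔ α = 0)
    (habs_mul : ∀ α β, abs (α * β) = abs α * abs β) : abs 1 = 1 := by
  have h1 := habs_mul 1 1
  have h2 : abs 1 ≠ 0 := fun h => one_ne_zero ((habs_zero 1).1 h)
  rw [mul_one] at h1
  exact (mul_right_cancel₀ h2 (by rw [← h1, one_mul])).symm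

section basics

variable {K : Type*} [Field K] {n : ℕ} {abs : K → ℝ} {ε : ℝ}
  {I : Ideal (AddMonoidAlgebra K (Fin n → ℤ))} {p : AddMonoidAlgebra K (Fin n → ℤ) → ℝ}

theorem berk_one (h1 : abs 1 = 1) (hp : IsBerkPointPow abs ε I p) : p 1 = 1 := by
  have := hp.2.2.2.1 1 one_ne_zero
  rw [h1, Real.one_rpow] at this
  exact this

theorem berk_mono_add (hp : IsBerkPointPow abs ε I p) (u v : Fin n → ℤ) :
    p (AddMonoidAlgebra.single (u + v) (1 : K)) =
      p (AddMonoidAlgebra.single u (1 : K)) * p (AddMonoidAlgebra.single v (1 : K)) := by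
  rw [← hp.2.1, AddMonoidAlgebra.single_mul_single, one_mul]

theorem berk_mono_pos (h1 : abs 1 = 1) (hp : IsBerkPointPow abs ε I p) (u : Fin n → ℤ) :
    0 < p (AddMonoidAlgebra.single u (1 : K)) := by
  refine lt_of_le_of_ne (hp.1 _) fun h => ?_
  have h2 := berk_mono_add hp u (-u)
  rw [← h, zero_mul, add_neg_cancel] at h2
  have h3 := berk_one h1 hp
  rw [AddMonoidAlgebra.one_def, h2] at h3
  exact zero_ne_one h3

theorem berk_mono (h1 : abs 1 = 1) (hp : IsBerkPointPow abs ε I p) (u : Fin n → ℤ) :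
    p (AddMonoidAlgebra.single u (1 : K)) =
      Real.exp (-∑ i, (u i : ℝ) * tropOfPoint p i) := by
  let φ : (Fin n → ℤ) →+ ℝ :=
    AddMonoidHom.mk' (fun u => - Real.log (p (AddMonoidAlgebra.single u (1 : K)))) (by
      intro u v
      rw [berk_mono_add hp, Real.log_mul (berk_mono_pos h1 hp u).ne' (berk_mono_pos h1 hp v).ne']
      ring)
  have h2 : φ u = ∑ i, (u i : ℝ) * tropOfPoint p i := by
    conv_lhs => rw [← Finset.univ_sum_single u]
    rw [map_sum]
    refine Finset.sum_congr rfl fun i _ => ?_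
    have : (Pi.single i (u i) : Fin n → ℤ) = u i • (Pi.single i 1 : Fin n → ℤ) := by
      rw [← Pi.single_smul]; simp
    rw [this, map_zsmul, zsmul_eq_mul]
    rfl
  rw [← h2]
  change _ = Real.exp (- - Real.log _)
  rw [neg_neg, Real.exp_log (berk_mono_pos h1 hp u)]

theorem berk_scale (h1 : abs 1 = 1) (habs_nonneg : ∀ α, 0 ≤ abs α)
    (habs_zero : ∀ α, abs α = 0 ↔ α = 0)
    (hp : IsBerkPointPow abs ε I p) (t : ℝ) (ht : 0 ≤ t) :
    t • tropOfPoint p ∈ tropSet abs (t * ε) I := by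
  classical
  refine ⟨fun f => if p f = 0 then 0 else p f ^ t, ⟨?_, ?_, ?_, ?_, ?_, ?_⟩, ?_⟩
  · intro f
    dsimp only
    split_ifs
    · exact le_rfl
    · exact Real.rpow_nonneg (hp.1 f) t
  · intro f g
    dsimp only
    rw [hp.2.1]
    by_cases hf : p f = 0
    · simp [hf]
    by_cases hg : p g = 0
    · simp [hg]
    simp only [hf, hg, mul_eq_zero, or_self, if_false]
    exact Real.mul_rpow (hp.1 f) (hp.1 g)
  · intro f g
    have key : ∀ a b : ℝ, 0 ≤ a → a ≤ b →
        (if a = 0 then 0 else a ^ t) ≤ (if b = 0 then 0 else b ^ t) := by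
      intro a b ha hab
      by_cases ha0 : a = 0
      · simp only [ha0, if_true]
        split_ifs
        · exact le_rfl
        · exact Real.rpow_nonneg (ha.trans hab) t
      · have hb0 : b ≠ 0 := fun h => ha0 (le_antisymm (h ▸ hab) ha)
        simp only [ha0, hb0, if_false]
        exact Real.rpow_le_rpow ha hab ht
    rcases le_max_iff.1 (hp.2.2.1 f g) with h | h
    · exact le_max_of_le_left (key _ _ (hp.1 _) h)
    · exact le_max_of_le_right (key _ _ (hp.1 _) h)
  · intro α hα
    have h0 : 0 < abs α := lt_of_le_of_ne (habs_nonneg _) fun h => hα ((habs_zero _).1 h.symm)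
    dsimp only
    rw [hp.2.2.2.1 α hα, if_neg (Real.rpow_pos_of_pos h0 _).ne', ← Real.rpow_mul h0.le, mul_comm]
  · simp [hp.2.2.2.2.1]
  · intro f hf
    simp [hp.2.2.2.2.2 f hf]
  · ext i
    have h2 := berk_mono_pos h1 hp (Pi.single i 1 : Fin n → ℤ)
    simp only [tropOfPoint, h2.ne', if_false, Pi.smul_apply, smul_eq_mul]
    rw [Real.log_rpow h2]
    ring

end basics

theorem cone_scale {K : Type*} [Field K] {n : ℕ} (abs : K → ℝ)
    (habs_nonneg : ∀ α, 0 ≤ abs α)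
    (habs_zero : ∀ α, abs α = 0 ↔ α = 0)
    (habs_mul : ∀ α β, abs (α * β) = abs α * abs β)
    (I : Ideal (AddMonoidAlgebra K (Fin n → ℤ))) :
    (∀ t : ℝ, 0 ≤ t → ∀ x ∈ tropCone abs I, (t • x.1, t * x.2) ∈ tropCone abs I) := by
  rintro t ht ⟨x, e⟩ ⟨he, p, hp, rfl⟩
  exact ⟨mul_nonneg ht he, 
    berk_scale (auxAbsOne abs habs_zero habs_mul) habs_nonneg habs_zero hp t ht⟩

theorem cone_fibre {K : Type*} [Field K] {n : ℕ} (abs : K → ℝ)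
    (habs_nonneg : ∀ α, 0 ≤ abs α)
    (habs_zero : ∀ α, abs α = 0 ↔ α = 0)
    (habs_mul : ∀ α β, abs (α * β) = abs α * abs β)
    (I : Ideal (AddMonoidAlgebra K (Fin n → ℤ))) :
    (∀ ε : ℝ, 0 < ε → {ω | (ω, ε) ∈ tropCone abs I} = ε • tropSet abs 1 I) := by
  intro ε hε
  ext ω
  constructor
  · intro h
    have h2 := cone_scale abs habs_nonneg habs_zero habs_mul I ε⁻¹ (inv_nonneg.2 hε.le) _ h
    refine Set.mem_smul_set.2 ⟨ε⁻¹ • ω, ?_, ?_⟩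
    · have := h2.2
      dsimp only at this
      rwa [inv_mul_cancel₀ hε.ne'] at this
    · rw [smul_smul, mul_inv_cancel₀ hε.ne', one_smul]
  · intro h
    obtain ⟨τ, hτ, rfl⟩ := Set.mem_smul_set.1 h
    have h2 := cone_scale abs habs_nonneg habs_zero habs_mul I ε hε.le (τ, 1) ⟨zero_le_one, hτ⟩
    simpa using h2

theorem cone_closed {K : Type*} [Field K] {n : ℕ} (abs : K → ℝ)
    (habs_nonneg : ∀ α, 0 ≤ abs α)
    (habs_zero : ∀ α, abs α = 0 ↔ α = 0)
    (habs_mul : ∀ α β, abs (α * β) = abs α * abs β)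
    (I : Ideal (AddMonoidAlgebra K (Fin n → ℤ))) : IsClosed (tropCone abs I) := by
  classical
  have h1 := auxAbsOne abs habs_zero habs_mul
  rw [isClosed_iff_ultrafilter]
  intro x U hU hmem
  have hP : ∀ z : (Fin n → ℝ) × ℝ, ∃ P : AddMonoidAlgebra K (Fin n → ℤ) → ℝ,
      z ∈ tropCone abs I → IsBerkPointPow abs z.2 I P ∧ tropOfPoint P = z.1 := by
    intro z
    by_cases hz : z ∈ tropCone abs I
    · obtain ⟨-, P, h, h'⟩ := hz
      exact ⟨P, fun _ => ⟨h, h'⟩⟩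
    · exact ⟨0, fun h => absurd h hz⟩
  choose P hP using hP
  have hev : ∀ᶠ z in (U : Filter _), z ∈ tropCone abs I := hmem
  have hmono : ∀ u : Fin n → ℤ, Filter.Tendsto (fun z => P z (AddMonoidAlgebra.single u (1 : K))) U
      (nhds (Real.exp (-∑ i, (u i : ℝ) * x.1 i))) := by
    intro u
    have hc : Continuous fun z : (Fin n → ℝ) × ℝ => Real.exp (-∑ i, (u i : ℝ) * z.1 i) := by
      fun_prop
    refine ((hc.tendsto x).mono_left hU).congr' ?_
    filter_upwards [hev] with z hz
    rw [berk_mono h1 (hP z hz).1, (hP z hz).2]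
  have hconst : ∀ α : K, α ≠ 0 → 
      Filter.Tendsto (fun z => P z (AddMonoidAlgebra.single (0 : Fin n → ℤ) α)) U
      (nhds (abs α ^ x.2)) := by
    intro α hα
    have h0 : 0 < abs α := lt_of_le_of_ne (habs_nonneg _) fun h => hα ((habs_zero _).1 h.symm)
    have hc : Continuous fun z : (Fin n → ℝ) × ℝ => abs α ^ z.2 := 
      continuous_const.rpow continuous_snd (fun _ => Or.inl h0.ne')
    refine ((hc.tendsto x).mono_left hU).congr' ?_
    filter_upwards [hev] with z hz
    rw [(hP z hz).1.2.2.2.1 α hα]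
  have hbd : ∀ f : AddMonoidAlgebra K (Fin n → ℤ), ∃ M : ℝ, ∀ᶠ z in (U : Filter _), P z f ≤ M := by
    intro f
    induction f using AddMonoidAlgebra.induction_linear with
    | zero => 
      refine ⟨0, ?_⟩
      filter_upwards [hev] with z hz
      exact (hP z hz).1.2.2.2.2.1.le
    | add f g hf hg => 
      obtain ⟨M, hM⟩ := hf
      obtain ⟨M', hM'⟩ := hg
      refine ⟨max M M', ?_⟩
      filter_upwards [hev, hM, hM'] with z hz h2 h3
      exact ((hP z hz).1.2.2.1 f g).trans (max_le_max h2 h3)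
    | single u a => 
      by_cases ha : a = 0
      · refine ⟨0, ?_⟩
        filter_upwards [hev] with z hz
        rw [ha, AddMonoidAlgebra.single_zero]
        exact (hP z hz).1.2.2.2.2.1.le
      · have ht := (hconst a ha).mul (hmono u)
        refine ⟨abs a ^ x.2 * Real.exp (-∑ i, (u i : ℝ) * x.1 i) + 1, ?_⟩
        · filter_upwards [hev, ht.eventually (ge_mem_nhds (lt_add_one _))] with z hz h2
          rw [← (hP z hz).1.2.1, AddMonoidAlgebra.single_mul_single, zero_add, mul_one] at h2
          exact h2
  have hlim : ∀ f, ∃ l : ℝ, Filter.Tendsto (fun z => P z f) U (nhds l) := by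
    intro f
    obtain ⟨M, hM⟩ := hbd f
    have := (isCompact_Icc (a := (0:ℝ)) (b := M)).ultrafilter_le_nhds' (U.map (fun z => P z f)) (by
      change ∀ᶠ z in (U : Filter _), P z f ∈ Set.Icc 0 M
      filter_upwards [hev, hM] with z hz h2
      exact ⟨(hP z hz).1.1 f, h2⟩)
    obtain ⟨l, -, hl⟩ := this
    exact ⟨l, hl⟩
  choose p hp using hlim
  refine ⟨?_, p, ⟨?_, ?_, ?_, ?_, ?_, ?_⟩, ?_⟩
  · have hc : Filter.Tendsto (fun z : (Fin n → ℝ) × ℝ => z.2) U (nhds x.2) := 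
      (continuous_snd.tendsto x).mono_left hU
    exact ge_of_tendsto hc (by filter_upwards [hev] with z hz using hz.1)
  · intro f
    exact ge_of_tendsto (hp f) (by filter_upwards [hev] with z hz using (hP z hz).1.1 f)
  · intro f g
    refine tendsto_nhds_unique (hp (f * g)) (((hp f).mul (hp g)).congr' ?_)
    filter_upwards [hev] with z hz using ((hP z hz).1.2.1 f g).symm
  · intro f g
    refine le_of_tendsto_of_tendsto (hp (f + g)) ((hp f).max (hp g)) ?_
    filter_upwards [hev] with z hz using (hP z hz).1.2.2.1 f g
  · intro α hα
    exact tendsto_nhds_unique (hp _) (hconst α hα)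
  · refine tendsto_nhds_unique (hp 0) (tendsto_const_nhds.congr' ?_)
    filter_upwards [hev] with z hz using (hP z hz).1.2.2.2.2.1.symm
  · intro f hf
    refine tendsto_nhds_unique (hp f) (tendsto_const_nhds.congr' ?_)
    filter_upwards [hev] with z hz using ((hP z hz).1.2.2.2.2.2 f hf).symm
  · ext i
    have := tendsto_nhds_unique (hp _) (hmono (Pi.single i 1))
    rw [tropOfPoint, this, Real.log_exp, neg_neg]
    rw [Finset.sum_eq_single i]
    · simp
    · intro j _ hj
      simp [Pi.single_eq_of_ne hj]
    · simp

section main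

variable {K L : Type*} [Field K] [Field L] [Algebra K L] {n : ℕ} {abs : K → ℝ}
  {I : Ideal (AddMonoidAlgebra K (Fin n → ℤ))}

theorem berk_of_q (θ : AddMonoidAlgebra K (Fin n → ℤ) →ₐ[K] L) (hI : ∀ f ∈ I, θ f = 0)
    (q : L → ℝ) (h1 : ∀ x, 0 ≤ q x) (h2 : ∀ x, q x = 0 ↔ x = 0)
    (h3 : ∀ x y, q (x * y) = q x * q y)
    (h4 : ∀ x y, q (x + y) ≤ max (q x) (q y)) (h5 : ∀ c : K, q (algebraMap K L c) = abs c) :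
    IsBerkPointPow abs 1 I (fun f => q (θ f)) := by
  refine ⟨fun f => h1 _, fun f g => ?_, fun f g => ?_, fun α _ => ?_, ?_, fun f hf => ?_⟩
  · dsimp only
    rw [map_mul, h3]
  · dsimp only
    rw [map_add]; exact h4 _ _
  · have : θ (AddMonoidAlgebra.single (0 : Fin n → ℤ) α) = algebraMap K L α := θ.commutes α
    dsimp only
    rw [this, h5, Real.rpow_one]
  · dsimp only
    rw [map_zero]; exact (h2 0).2 rfl
  · exact (h2 _).2 (hI f hf)

/-- The image of a monomial. -/
noncomputable def Emon (θ : AddMonoidAlgebra K (Fin n → ℤ) →ₐ[K] L) (u : Fin n → ℤ) : L :=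
  θ (AddMonoidAlgebra.single u (1 : K))

theorem Emon_add (θ : AddMonoidAlgebra K (Fin n → ℤ) →ₐ[K] L) (u v : Fin n → ℤ) :
    Emon θ (u + v) = Emon θ u * Emon θ v := by
  rw [Emon, Emon, Emon, ← map_mul, AddMonoidAlgebra.single_mul_single, one_mul]

theorem Emon_zero (θ : AddMonoidAlgebra K (Fin n → ℤ) →ₐ[K] L) : Emon θ 0 = 1 := by
  rw [Emon, ← AddMonoidAlgebra.one_def, map_one]

theorem Emon_neg (θ : AddMonoidAlgebra K (Fin n → ℤ) →ₐ[K] L) (u : Fin n → ℤ) :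
    Emon θ (-u) = (Emon θ u)⁻¹ := by
  refine eq_inv_of_mul_eq_one_left ?_
  rw [← Emon_add, neg_add_cancel, Emon_zero]

theorem Emon_mem (θ : AddMonoidAlgebra K (Fin n → ℤ) →ₐ[K] L)
    (F : IntermediateField K L) (hF : ∀ i, Emon θ (Pi.single i 1) ∈ F) (u : Fin n → ℤ) :
    Emon θ u ∈ F := by
  let G : AddSubgroup (Fin n → ℤ) :=
    { carrier := {u | Emon θ u ∈ F}
      add_mem' := fun {a b} ha hb => by
        change Emon θ (a + b) ∈ F
        rw [Emon_add]; exact mul_mem ha hb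
      zero_mem' := by
        change Emon θ 0 ∈ F
        rw [Emon_zero]; exact one_mem F
      neg_mem' := fun {a} ha => by
        change Emon θ (-a) ∈ F
        rw [Emon_neg]; exact inv_mem ha }
  change u ∈ G
  rw [← Finset.univ_sum_single u]
  refine sum_mem fun i _ => ?_
  have : (Pi.single i (u i) : Fin n → ℤ) = u i • (Pi.single i 1 : Fin n → ℤ) := by
    rw [← Pi.single_smul]; simp
  rw [this]
  have hG : (Pi.single i 1 : Fin n → ℤ) ∈ G := hF i
  exact zsmul_mem hG _

theorem all_mem (θ : AddMonoidAlgebra K (Fin n → ℤ) →ₐ[K] L)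
    (hfrac : ∀ x : L, ∃ f g, x = θ f / θ g)
    (F : IntermediateField K L) (hF : ∀ i, Emon θ (Pi.single i 1) ∈ F) (x : L) : x ∈ F := by
  have h : ∀ f, θ f ∈ F := by
    intro f
    induction f using AddMonoidAlgebra.induction_linear with
    | zero => rw [map_zero]; exact zero_mem F
    | add f g hf hg => rw [map_add]; exact add_mem hf hg
    | single u a =>
      have : (AddMonoidAlgebra.single u a : AddMonoidAlgebra K (Fin n → ℤ)) =
          a • AddMonoidAlgebra.single u (1 : K) := by
        rw [AddMonoidAlgebra.smul_single, smul_eq_mul, mul_one]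
      rw [this, map_smul]
      exact F.smul_mem (Emon_mem θ F hF u)
  obtain ⟨f, g, rfl⟩ := hfrac x
  exact div_mem (h f) (h g)

theorem lemQ
    (habs_nonneg : ∀ α, 0 ≤ abs α)
    (habs_zero : ∀ α, abs α = 0 ↔ α = 0)
    (habs_mul : ∀ α β, abs (α * β) = abs α * abs β)
    (habs_add : ∀ α β, abs (α + β) ≤ max (abs α) (abs β))
    (hnontriv : ∃ α : K, α ≠ 0 ∧ abs α ≠ 1)
    (p : AddMonoidAlgebra K (Fin n → ℤ) → ℝ) (hp : IsBerkPointPow abs 0 I p)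
    (θ : AddMonoidAlgebra K (Fin n → ℤ) →ₐ[K] L) (hker : ∀ f, θ f = 0 ↔ p f = 0)
    (hfrac : ∀ x : L, ∃ f g, x = θ f / θ g)
    (S : Finset (Fin n → ℤ)) (hS : ∀ u ∈ S, 0 ≤ ∑ i, (u i : ℝ) * tropOfPoint p i)
    (u0 : Fin n → ℤ) (hu0 : u0 ∈ S) (hpos : 0 < ∑ i, (u0 i : ℝ) * tropOfPoint p i)
    (k : ℕ) (hk : ∀ i, (Pi.single i 1 + k • u0 : Fin n → ℤ) ∈ S) :
    ∃ C : ℝ, 0 ≤ C ∧ ∀ T : ℝ, ∃ τ ∈ tropSet abs 1 I, (∀ u ∈ S, -C ≤ ∑ i, (u i : ℝ) * τ i) ∧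
      T ≤ ∑ i, (u0 i : ℝ) * τ i := by
  classical
  have h1 := auxAbsOne abs habs_zero habs_mul
  have hmemS : ∀ u ∈ S, Emon θ u ∈ ((S.image (Emon θ) : Finset L) : Set L) := fun u hu =>
    Finset.mem_coe.2 (Finset.mem_image_of_mem _ hu)
  have hEp : ∀ u, p (AddMonoidAlgebra.single u (1 : K)) = 
      Real.exp (-∑ i, (u i : ℝ) * tropOfPoint p i) := berk_mono h1 hp
  obtain ⟨C, hC, hq⟩ := lemM abs habs_nonneg habs_zero habs_mul habs_add hnontriv
    (S.image (Emon θ)) (by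
      refine all_mem θ hfrac _ fun i => ?_
      have e1 : Emon θ u0 ∈ IntermediateField.adjoin K 
        ((S.image (Emon θ) : Finset L) : Set L) := IntermediateField.subset_adjoin _ _ (hmemS _ hu0)
      have e2 : Emon θ (Pi.single i 1 + k • u0) ∈ IntermediateField.adjoin K 
        ((S.image (Emon θ) : Finset L) : Set L) := IntermediateField.subset_adjoin _ _ (hmemS _ (hk i))
      have e3 : ∀ m : ℕ, Emon θ (m • u0) = Emon θ u0 ^ m := by
        intro m
        induction m with
        | zero => rw [zero_smul, Emon_zero, pow_zero]
        | succ m ih => rw [succ_nsmul, Emon_add, ih, pow_succ]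
      have e4 : Emon θ (Pi.single i 1) = 
          Emon θ (Pi.single i 1 + k • u0) * (Emon θ u0 ^ k)⁻¹ := by
        rw [← e3, ← Emon_neg, ← Emon_add, add_neg_cancel_right]
      rw [e4]
      exact mul_mem e2 (inv_mem (pow_mem e1 k)))
    (Emon θ u0) (Algebra.subset_adjoin (hmemS _ hu0)) (by
      have hle : ∀ z ∈ Algebra.adjoin K ((S.image (Emon θ) : Finset L) : Set L), 
          ∃ f, θ f = z ∧ p f ≤ 1 := by
        intro z hz
        induction hz using Algebra.adjoin_induction with
        | mem x hx => 
          obtain ⟨u, hu, rfl⟩ := Finset.mem_image.1 (Finset.mem_coe.1 hx)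
          refine ⟨_, rfl, ?_⟩
          rw [hEp, Real.exp_le_one_iff]
          linarith [hS u hu]
        | algebraMap r => 
          refine ⟨algebraMap K _ r, θ.commutes r, ?_⟩
          by_cases hr : r = 0
          · rw [hr, map_zero, hp.2.2.2.2.1]; exact zero_le_one
          · have := hp.2.2.2.1 r hr
            rw [Real.rpow_zero] at this
            exact this.le
        | add x y _ _ hx hy => 
          obtain ⟨f, rfl, hf⟩ := hx
          obtain ⟨g, rfl, hg⟩ := hy
          exact ⟨f + g, map_add _ _ _, (hp.2.2.1 f g).trans (max_le hf hg)⟩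
        | mul x y _ _ hx hy => 
          obtain ⟨f, rfl, hf⟩ := hx
          obtain ⟨g, rfl, hg⟩ := hy
          refine ⟨f * g, map_mul _ _ _, ?_⟩
          rw [hp.2.1]
          exact mul_le_one₀ hf (hp.1 g) hg
      intro z hz hyz
      obtain ⟨f, rfl, hf⟩ := hle z hz
      have e1 : θ (1 - AddMonoidAlgebra.single u0 (1 : K) * f) = 0 := by
        rw [map_sub, map_one, map_mul, sub_eq_zero]
        exact hyz.symm
      have e2 := hp.2.2.1 (AddMonoidAlgebra.single u0 (1 : K) * f) 
        (1 - AddMonoidAlgebra.single u0 (1 : K) * f)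
      rw [add_sub_cancel, berk_one h1 hp, (hker _).1 e1, hp.2.1, hEp] at e2
      have e3 : Real.exp (-∑ i, (u0 i : ℝ) * tropOfPoint p i) < 1 := by
        rw [Real.exp_lt_one_iff]; linarith
      have e4 : Real.exp (-∑ i, (u0 i : ℝ) * tropOfPoint p i) * p f < 1 := 
        (mul_le_of_le_one_right (Real.exp_pos _).le hf).trans_lt e3
      exact absurd e2 (not_le.2 (max_lt e4 one_pos)))
  refine ⟨max 0 (Real.log C), le_max_left _ _, fun T => ?_⟩
  obtain ⟨q, q1, q2, q3, q4, q5, q6, q7⟩ := hq (Real.exp (-T)) (Real.exp_pos _)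
  have hb : IsBerkPointPow abs 1 I (fun f => q (θ f)) := 
    berk_of_q θ (fun f hf => (hker f).2 (hp.2.2.2.2.2 f hf)) q q1 q2 q3 q4 q5
  refine ⟨_, ⟨_, hb, rfl⟩, ?_, ?_⟩
  · intro u hu
    have e1 := q6 _ (Finset.mem_image_of_mem (Emon θ) hu)
    have e2 := berk_mono h1 hb u
    change q (Emon θ u) = _ at e2
    rw [e2, ← Real.le_log_iff_exp_le hC] at e1
    linarith [le_max_right 0 (Real.log C)]
  · have e2 := berk_mono h1 hb u0
    change q (Emon θ u0) = _ at e2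
    rw [e2, Real.exp_le_exp] at q7
    linarith

theorem nonempty_of_point
    (habs_nonneg : ∀ α, 0 ≤ abs α)
    (habs_zero : ∀ α, abs α = 0 ↔ α = 0)
    (habs_mul : ∀ α β, abs (α * β) = abs α * abs β)
    (habs_add : ∀ α β, abs (α + β) ≤ max (abs α) (abs β))
    (hnontriv : ∃ α : K, α ≠ 0 ∧ abs α ≠ 1)
    (θ : AddMonoidAlgebra K (Fin n → ℤ) →ₐ[K] L) (hI : ∀ f ∈ I, θ f = 0)
    (hfrac : ∀ x : L, ∃ f g, x = θ f / θ g) : (tropSet abs 1 I).Nonempty := by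
  classical
  obtain ⟨C, hC, hq⟩ := lemM abs habs_nonneg habs_zero habs_mul habs_add hnontriv
    (Finset.univ.image fun i => Emon θ (Pi.single i 1)) (by
      refine all_mem θ hfrac _ fun i => ?_
      exact IntermediateField.subset_adjoin _ _ 
        (Finset.mem_coe.2 (Finset.mem_image_of_mem _ (Finset.mem_univ i)))) 
    0 (zero_mem _) (fun z _ => by rw [zero_mul]; exact zero_ne_one)
  obtain ⟨q, q1, q2, q3, q4, q5, q6, q7⟩ := hq 1 one_pos
  exact ⟨_, _, berk_of_q θ hI q q1 q2 q3 q4 q5, rfl⟩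

theorem mem_closure_zero
    (habs_nonneg : ∀ α, 0 ≤ abs α)
    (habs_zero : ∀ α, abs α = 0 ↔ α = 0)
    (habs_mul : ∀ α β, abs (α * β) = abs α * abs β)
    (habs_add : ∀ α β, abs (α + β) ≤ max (abs α) (abs β))
    (hnontriv : ∃ α : K, α ≠ 0 ∧ abs α ≠ 1)
    (p : AddMonoidAlgebra K (Fin n → ℤ) → ℝ) (hp : IsBerkPointPow abs 0 I p)
    (θ : AddMonoidAlgebra K (Fin n → ℤ) →ₐ[K] L) (hker : ∀ f, θ f = 0 ↔ p f = 0)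
    (hfrac : ∀ x : L, ∃ f g, x = θ f / θ g) :
    (tropOfPoint p, (0 : ℝ)) ∈ closure {x : (Fin n → ℝ) × ℝ |
        ∃ t : ℝ, 0 ≤ t ∧ ∃ ω ∈ tropSet abs 1 I, x = (t • ω, t)} := by
  classical
  by_cases hω : tropOfPoint p = 0
  · obtain ⟨τ, hτ⟩ := nonempty_of_point habs_nonneg habs_zero habs_mul habs_add hnontriv θ
      (fun f hf => (hker f).2 (hp.2.2.2.2.2 f hf)) hfrac
    refine subset_closure ⟨0, le_rfl, τ, hτ, ?_⟩
    rw [hω, zero_smul]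
  obtain ⟨i0, hi0⟩ : ∃ i, tropOfPoint p i ≠ 0 := by
    by_contra hc
    push Not at hc
    exact hω (funext hc)
  generalize hωd : tropOfPoint p = ω at *
  obtain ⟨σ, W, hW, hσW⟩ : ∃ (σ : ℤ) (W : ℝ), 0 < W ∧ σ * ω i0 = W := by
    rcases lt_or_gt_of_ne hi0 with h | h
    · exact ⟨-1, -ω i0, by linarith, by push_cast; ring⟩
    · exact ⟨1, ω i0, h, by push_cast; ring⟩
  let u0 : Fin n → ℤ := Pi.single i0 σ
  have hsing : ∀ (τ : Fin n → ℝ) (i : Fin n) (a : ℤ), 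
      ∑ j, (((Pi.single i a : Fin n → ℤ) j : ℤ) : ℝ) * τ j = a * τ i := by
    intro τ i a
    rw [Finset.sum_eq_single i]
    · simp
    · intro j _ hj
      simp [Pi.single_eq_of_ne hj]
    · simp
  have hlin : ∀ (τ : Fin n → ℝ) (i : Fin n) (a b : ℤ), 
      ∑ j, (((a • (Pi.single i 1 : Fin n → ℤ) + b • u0) j : ℤ) : ℝ) * τ j = 
        a * τ i + b * (∑ j, ((u0 j : ℤ) : ℝ) * τ j) := by
    intro τ i a b
    have e := hsing τ i 1
    rw [Int.cast_one, one_mul] at e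
    rw [← e, Finset.mul_sum, Finset.mul_sum, ← Finset.sum_add_distrib]
    refine Finset.sum_congr rfl fun j _ => ?_
    simp only [Pi.add_apply, Pi.smul_apply, smul_eq_mul]
    push_cast
    ring
  have hu0 : ∑ j, ((u0 j : ℤ) : ℝ) * ω j = W := by rw [hsing, hσW]
  obtain ⟨k, hk⟩ : ∃ k : ℕ, ∀ i, 0 ≤ ω i + k * W := by
    obtain ⟨k, hk⟩ := exists_nat_ge ((∑ i, |ω i|) / W)
    refine ⟨k, fun i => ?_⟩
    rw [div_le_iff₀ hW] at hk
    have e1 := Finset.single_le_sum (f := fun i => |ω i|) (fun i _ => abs_nonneg _) 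
      (Finset.mem_univ i)
    linarith [neg_abs_le (ω i)]
  rw [Metric.mem_closure_iff]
  intro δ hδ
  obtain ⟨N, hN⟩ := exists_nat_gt (2 * W / δ)
  have hN0 : (0 : ℝ) < N := lt_of_le_of_lt (by positivity) hN
  let a : Fin n → ℤ := fun i => ⌊N * ω i / W⌋
  have ha1 : ∀ i, a i * W ≤ N * ω i := fun i => by
    have := Int.floor_le (N * ω i / W)
    rwa [le_div_iff₀ hW] at this
  have ha2 : ∀ i, N * ω i ≤ (a i + 1) * W := fun i => by
    have := (Int.lt_floor_add_one (N * ω i / W)).le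
    rwa [div_le_iff₀ hW] at this
  let S : Finset (Fin n → ℤ) := insert u0 
    (Finset.univ.image (fun i => ((N : ℤ) • (Pi.single i 1 : Fin n → ℤ) + (-a i) • u0)) ∪
     Finset.univ.image (fun i => ((-(N : ℤ)) • (Pi.single i 1 : Fin n → ℤ) + (a i + 1) • u0)) ∪
     Finset.univ.image (fun i => ((1 : ℤ) • (Pi.single i 1 : Fin n → ℤ) + (k : ℤ) • u0)))
  have hS1 : ∀ i, ((N : ℤ) • (Pi.single i 1 : Fin n → ℤ) + (-a i) • u0) ∈ S := fun i =>
    Finset.mem_insert_of_mem (Finset.mem_union_left _ (Finset.mem_union_left _ 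
      (Finset.mem_image.2 ⟨i, Finset.mem_univ i, rfl⟩)))
  have hS2 : ∀ i, ((-(N : ℤ)) • (Pi.single i 1 : Fin n → ℤ) + (a i + 1) • u0) ∈ S := fun i =>
    Finset.mem_insert_of_mem (Finset.mem_union_left _ (Finset.mem_union_right _ 
      (Finset.mem_image.2 ⟨i, Finset.mem_univ i, rfl⟩)))
  have hS3 : ∀ i, ((1 : ℤ) • (Pi.single i 1 : Fin n → ℤ) + (k : ℤ) • u0) ∈ S := fun i =>
    Finset.mem_insert_of_mem (Finset.mem_union_right _
      (Finset.mem_image.2 ⟨i, Finset.mem_univ i, rfl⟩))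
  obtain ⟨C, hC, hT⟩ := lemQ habs_nonneg habs_zero habs_mul habs_add hnontriv p hp θ hker hfrac S
    (by
      rw [hωd]
      intro u hu
      rcases Finset.mem_insert.1 hu with rfl | hu
      · rw [hu0]; exact hW.le
      rcases Finset.mem_union.1 hu with hu | hu
      · rcases Finset.mem_union.1 hu with hu | hu
        · obtain ⟨i, -, rfl⟩ := Finset.mem_image.1 hu
          rw [hlin, hu0]
          push_cast
          linarith [ha1 i]
        · obtain ⟨i, -, rfl⟩ := Finset.mem_image.1 hu
          rw [hlin, hu0]
          push_cast
          linarith [ha2 i]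
      · obtain ⟨i, -, rfl⟩ := Finset.mem_image.1 hu
        rw [hlin, hu0]
        push_cast
        linarith [hk i])
    u0 (Finset.mem_insert_self _ _) (by rw [hωd, hu0]; exact hW) k (fun i => by
      have := hS3 i
      rwa [one_smul, natCast_zsmul] at this)
  obtain ⟨τ, hτ, hτS, hτT⟩ := hT (max (C + 1) (W / δ + 1))
  have hC' := (le_max_left _ _).trans hτT
  have hδ' := (le_max_right _ _).trans hτT
  have b1 : ∀ i, -C ≤ N * τ i - a i * (∑ j, ((u0 j : ℤ) : ℝ) * τ j) := fun i => by
    have := hτS _ (hS1 i)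
    rw [hlin] at this
    push_cast at this
    linarith
  have b2 : ∀ i, -C ≤ - N * τ i + (a i + 1) * (∑ j, ((u0 j : ℤ) : ℝ) * τ j) := fun i => by
    have := hτS _ (hS2 i)
    rw [hlin] at this
    push_cast at this
    linarith
  generalize (∑ j, ((u0 j : ℤ) : ℝ) * τ j) = T at *
  have hT0 : 0 < T := by linarith
  refine ⟨_, ⟨W / T, by positivity, τ, hτ, rfl⟩, ?_⟩
  rw [Prod.dist_eq, max_lt_iff]
  constructor
  · rw [dist_pi_lt_iff hδ]
    intro i
    rw [Real.dist_eq]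
    change |ω i - W / T * τ i| < δ
    have hNδ : 2 * W < N * δ := by rwa [div_lt_iff₀ hδ] at hN
    have c1 : ω i - W / T * τ i = (N * ω i * T - W * (N * τ i)) / (N * T) := by
      field_simp
    rw [c1, abs_lt, lt_div_iff₀ (by positivity), div_lt_iff₀ (by positivity)]
    have d1 := ha1 i
    have d2 := ha2 i
    have d3 := b1 i
    have d4 := b2 i
    have f1 := mul_le_mul_of_nonneg_right d1 hT0.le
    have f2 := mul_le_mul_of_nonneg_right d2 hT0.le
    have f3 := mul_le_mul_of_nonneg_left d3 hW.le
    have f4 := mul_le_mul_of_nonneg_left d4 hW.le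
    have f5 := mul_lt_mul_of_pos_right hNδ hT0
    have f6 := mul_le_mul_of_nonneg_left hC' hW.le
    constructor <;> nlinarith
  · rw [Real.dist_eq, zero_sub, abs_neg, abs_of_pos (by positivity), div_lt_iff₀ hT0]
    have : W / δ < T := by linarith
    rwa [div_lt_iff₀ hδ, mul_comm] at this

end main

theorem mem_closure_zero' {K : Type*} [Field K] {n : ℕ} {abs : K → ℝ}
    {I : Ideal (AddMonoidAlgebra K (Fin n → ℤ))}
    (habs_nonneg : ∀ α, 0 ≤ abs α)
    (habs_zero : ∀ α, abs α = 0 ↔ α = 0)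
    (habs_mul : ∀ α β, abs (α * β) = abs α * abs β)
    (habs_add : ∀ α β, abs (α + β) ≤ max (abs α) (abs β))
    (hnontriv : ∃ α : K, α ≠ 0 ∧ abs α ≠ 1)
    (p : AddMonoidAlgebra K (Fin n → ℤ) → ℝ) (hp : IsBerkPointPow abs 0 I p) :
    (tropOfPoint p, (0 : ℝ)) ∈ closure {x : (Fin n → ℝ) × ℝ |
        ∃ t : ℝ, 0 ≤ t ∧ ∃ ω ∈ tropSet abs 1 I, x = (t • ω, t)} := by
  have h1 := auxAbsOne abs habs_zero habs_mul
  let 𝔭 : Ideal (AddMonoidAlgebra K (Fin n → ℤ)) :=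
    { carrier := {f | p f = 0}
      add_mem' := fun {f g} hf hg => le_antisymm 
        ((hp.2.2.1 f g).trans (max_le (le_of_eq hf) (le_of_eq hg))) (hp.1 _)
      zero_mem' := hp.2.2.2.2.1
      smul_mem' := fun c f hf => by
        change p (c * f) = 0
        rw [hp.2.1, show p f = 0 from hf, mul_zero] }
  have h𝔭 : ∀ f, f ∈ 𝔭 ↔ p f = 0 := fun f => Iff.rfl
  have hprime : 𝔭.IsPrime := by
    refine ⟨?_, ?_⟩
    · rw [Ideal.ne_top_iff_one, h𝔭, berk_one h1 hp]
      exact one_ne_zero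
    · intro f g hfg
      rw [h𝔭, hp.2.1, mul_eq_zero] at hfg
      exact hfg
  let D := AddMonoidAlgebra K (Fin n → ℤ) ⧸ 𝔭
  let θ : AddMonoidAlgebra K (Fin n → ℤ) →ₐ[K] FractionRing D := 
    (IsScalarTower.toAlgHom K D (FractionRing D)).comp (Ideal.Quotient.mkₐ K 𝔭)
  have hθ : ∀ f, θ f = algebraMap D (FractionRing D) (Ideal.Quotient.mk 𝔭 f) := fun f => rfl
  refine mem_closure_zero habs_nonneg habs_zero habs_mul habs_add hnontriv p hp θ ?_ ?_
  · intro f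
    rw [hθ, FaithfulSMul.algebraMap_eq_zero_iff, Ideal.Quotient.eq_zero_iff_mem, h𝔭]
  · intro x
    obtain ⟨a, b, -, rfl⟩ := IsFractionRing.div_surjective (A := D) x
    obtain ⟨f, rfl⟩ := Ideal.Quotient.mk_surjective a
    obtain ⟨g, rfl⟩ := Ideal.Quotient.mk_surjective b
    exact ⟨f, g, rfl⟩

/-- For a nontrivially valued field `(K, abs)` and a closed subscheme `X` of the torus
given by the ideal `I`, the tropical cone `Trop_W(X)` is a closed cone:  it is stable
under scaling by `ℝ≥0`, its fibre over every `ε > 0` is `ε · Trop_v(X)`, and it is the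
closure in `ℝⁿ × ℝ≥0` of the cone generated by `Trop_v(X) × {1}`. -/
theorem stmt18 {K : Type*} [Field K] {n : ℕ}
    (abs : K → ℝ)
    (habs_nonneg : ∀ α, 0 ≤ abs α)
    (habs_zero : ∀ α, abs α = 0 ↔ α = 0)
    (habs_mul : ∀ α β, abs (α * β) = abs α * abs β)
    (habs_add : ∀ α β, abs (α + β) ≤ max (abs α) (abs β))
    (hnontriv : ∃ α : K, α ≠ 0 ∧ abs α ≠ 1)
    (I : Ideal (AddMonoidAlgebra K (Fin n → ℤ))) :
    -- Trop_W(X) is stable under scaling by ℝ≥0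
    (∀ t : ℝ, 0 ≤ t → ∀ x ∈ tropCone abs I, (t • x.1, t * x.2) ∈ tropCone abs I) ∧
    -- its fibre over each ε > 0 is ε · Trop_v(X)
    (∀ ε : ℝ, 0 < ε → {ω | (ω, ε) ∈ tropCone abs I} = ε • tropSet abs 1 I) ∧
    -- it is the closure of the cone generated by Trop_v(X) × {1}
    tropCone abs I =
      closure {x : (Fin n → ℝ) × ℝ |
        ∃ t : ℝ, 0 ≤ t ∧ ∃ ω ∈ tropSet abs 1 I, x = (t • ω, t)} := by
  have hsc := cone_scale abs habs_nonneg habs_zero habs_mul I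
  have hfib := cone_fibre abs habs_nonneg habs_zero habs_mul I
  refine ⟨hsc, hfib, Set.Subset.antisymm ?_ ?_⟩
  · rintro ⟨ω, ε⟩ hx
    have hε : 0 ≤ ε := hx.1
    rcases hε.eq_or_lt with rfl | hε
    · obtain ⟨-, p, hp, hpω⟩ := hx
      have := mem_closure_zero' habs_nonneg habs_zero habs_mul habs_add hnontriv p hp
      rwa [hpω] at this
    · have h : ω ∈ ε • tropSet abs 1 I := by
        rw [← hfib ε hε]; exact hx
      obtain ⟨τ, hτ, rfl⟩ := Set.mem_smul_set.1 h
      exact subset_closure ⟨ε, hε.le, τ, hτ, rfl⟩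
  · refine closure_minimal ?_ (cone_closed abs habs_nonneg habs_zero habs_mul I)
    rintro x ⟨t, ht, ω, hω, rfl⟩
    have := hsc t ht (ω, 1) ⟨zero_le_one, hω⟩
    simpa using this
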